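/- Let (x̄,λ̄) be a KKT point of the unperturbed problem (a,b)=(0,0). Define Σ(x̄,λ̄) = {(ξ,ζ) ∈ X × Y : ∇²ₓₓL(x̄,λ̄)ξ + ∇g(x̄)*(ζ + ½∇Υ(g'(x̄)ξ)) = 0} and Γ(x̄,λ̄) = {(ξ,ζ) ∈ X × Y : g'(x̄)ξ ∈ C_K(g(x̄),λ̄), ζ ∈ [C_K(g(x̄),λ̄)]°}. Suppose that ⟨g'(x̄)ξ, ζ⟩ ≥ 0 for every (ξ,ζ) ∈ Σ(x̄,λ̄) ∩ Γ(x̄,λ̄) and that the set ∇g(x̄)*[C_K(g(x̄),λ̄)]° is closed. Then, if the multiplier λ̄ is noncritical, the map X_KKT has the pseudo-isolated calmness at the origin for x̄ (relative to λ̄). -/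

import Mathlib

open Set Filter Topology Metric Pointwise
open scoped RealInnerProductSpace Classical

noncomputable section

/-- The normal cone of convex analysis: `N_K(z) = {l | ⟪l, y - z⟫ ≤ 0 ∀ y ∈ K}`,
empty when `z ∉ K`. -/
def nCone {E : Type*} [NormedAddCommGroup E] [InnerProductSpace ℝ E]
    (K : Set E) (z : E) : Set E :=
  {l | z ∈ K ∧ ∀ y ∈ K, ⟪l, y - z⟫ ≤ 0}

/-- The metric projection onto `K`: under the standing assumptions (`K` nonempty,
closed and convex in a finite-dimensional space) the distance minimizer exists and
is unique, so this choice-based definition is exactly the metric projection `Π_K`. -/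

def projK {E : Type*} [NormedAddCommGroup E] [InnerProductSpace ℝ E]
    (K : Set E) (z : E) : E :=
  if h : ∃ p, p ∈ K ∧ ∀ y ∈ K, ‖z - p‖ ≤ ‖z - y‖ then h.choose else 0

/-- A set `D` is a pointed closed convex cone. -/
def PointedClosedConvexCone {E : Type*} [NormedAddCommGroup E] [NormedSpace ℝ E]
    (D : Set E) : Prop :=
  IsClosed D ∧ Convex ℝ D ∧ (∀ t : ℝ, 0 ≤ t → ∀ z ∈ D, t • z ∈ D) ∧ D ∩ (-D) ⊆ {0}

/-- `K` is `C²`-cone reducible at `y`: near `y`, `K` is the inverse image of a pointed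
closed convex cone `D` under a twice continuously differentiable map `Ξ` with `Ξ y = 0`
and `Ξ'(y)` surjective.  (Since the target of the reduction is a finite-dimensional
space of dimension at most `dim Y`, it can be taken to be a Euclidean space.) -/
def C2ConeReducibleAt {Y : Type*} [NormedAddCommGroup Y] [InnerProductSpace ℝ Y]
    (K : Set Y) (y : Y) : Prop :=
  ∃ (m : ℕ) (U : Set Y) (D : Set (EuclideanSpace ℝ (Fin m)))
    (Ξ : Y → EuclideanSpace ℝ (Fin m)),
      IsOpen U ∧ y ∈ U ∧ PointedClosedConvexCone D ∧ ContDiffOn ℝ 2 Ξ U ∧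
      Ξ y = 0 ∧ Function.Surjective (fderiv ℝ Ξ y) ∧ K ∩ U = {y' ∈ U | Ξ y' ∈ D}

/-- `K` is `C²`-cone reducible (at every point of `K`). -/
def C2ConeReducible {Y : Type*} [NormedAddCommGroup Y] [InnerProductSpace ℝ Y]
    (K : Set Y) : Prop :=
  ∀ y ∈ K, C2ConeReducibleAt K y

/-- Calmness of a set-valued map `F` at `z0` for `w0 ∈ F z0`. -/
def Calm {Z W : Type*} [NormedAddCommGroup Z] [NormedAddCommGroup W]
    (F : Z → Set W) (z0 : Z) (w0 : W) : Prop :=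
  ∃ κ ε δ : ℝ, 0 < κ ∧ 0 < ε ∧ 0 < δ ∧
    ∀ z : Z, ‖z - z0‖ ≤ ε → ∀ w ∈ F z, ‖w - w0‖ ≤ δ →
      ∃ w' ∈ F z0, ‖w - w'‖ ≤ κ * ‖z - z0‖

/-- Isolated calmness of a set-valued map `F` at `z0` for `w0 ∈ F z0`. -/
def IsolatedCalm {Z W : Type*} [NormedAddCommGroup Z] [NormedAddCommGroup W]
    (F : Z → Set W) (z0 : Z) (w0 : W) : Prop :=
  ∃ κ ε δ : ℝ, 0 < κ ∧ 0 < ε ∧ 0 < δ ∧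
    ∀ z : Z, ‖z - z0‖ ≤ ε → ∀ w ∈ F z, ‖w - w0‖ ≤ δ →
      ‖w - w0‖ ≤ κ * ‖z - z0‖

/-- Metric subregularity of `F` at `z0` for `w0 ∈ F z0`:
`dist(z, F⁻¹(w0)) ≤ κ · dist(w0, F z ∩ B_δ(w0))` for `z` near `z0`; since the
right-hand side is an infimum over `F z ∩ B_δ(w0)` (`= +∞` when empty), this is
equivalently stated pointwise. -/
def MetricallySubregular {Z W : Type*} [NormedAddCommGroup Z] [NormedAddCommGroup W]
    (F : Z → Set W) (z0 : Z) (w0 : W) : Prop :=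
  ∃ κ ε δ : ℝ, 0 < κ ∧ 0 < ε ∧ 0 < δ ∧
    ∀ z : Z, ‖z - z0‖ ≤ ε → ∀ w ∈ F z, ‖w - w0‖ ≤ δ →
      infDist z {z' : Z | w0 ∈ F z'} ≤ κ * ‖w0 - w‖

/-- `φ` has directional derivative `w` at `z` in direction `h`. -/
def HasDirDeriv {E : Type*} [NormedAddCommGroup E] [NormedSpace ℝ E]
    (φ : E → E) (z h w : E) : Prop :=
  Tendsto (fun t : ℝ => t⁻¹ • (φ (z + t • h) - φ z)) (𝓝[>] (0 : ℝ)) (𝓝 w)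

/-- The contingent (Bouligand) tangent cone to `s` at `z`. -/
def contCone {E : Type*} [NormedAddCommGroup E] [NormedSpace ℝ E]
    (s : Set E) (z : E) : Set E :=
  {w | ∃ (t : ℕ → ℝ) (v : ℕ → E), (∀ n, 0 < t n) ∧ Tendsto t atTop (𝓝 0) ∧
        Tendsto v atTop (𝓝 w) ∧ ∀ n, z + t n • v n ∈ s}

/-- The negative polar cone of a set. -/
def negPolar {E : Type*} [NormedAddCommGroup E] [InnerProductSpace ℝ E]
    (C : Set E) : Set E :=
  {z | ∀ d ∈ C, ⟪z, d⟫ ≤ 0}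

/-- The critical cone `C_K(y,u) = T_K(y) ∩ u^⊥`. -/
def criticalCone {E : Type*} [NormedAddCommGroup E] [InnerProductSpace ℝ E]
    (K : Set E) (y u : E) : Set E :=
  contCone K y ∩ {d | ⟪u, d⟫ = 0}

/-- The (outer) second-order tangent set `T²_K(y,h)`. -/
def secondOrderTangent {E : Type*} [NormedAddCommGroup E] [NormedSpace ℝ E]
    (K : Set E) (y h : E) : Set E :=
  {w | ∃ (t : ℕ → ℝ) (v : ℕ → E), (∀ n, 0 < t n) ∧ Tendsto t atTop (𝓝 0) ∧
        Tendsto v atTop (𝓝 w) ∧ ∀ n, y + t n • h + ((t n) ^ 2 / 2) • v n ∈ K}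

variable {X Y : Type*} [NormedAddCommGroup X] [InnerProductSpace ℝ X]
  [FiniteDimensional ℝ X] [NormedAddCommGroup Y] [InnerProductSpace ℝ Y]
  [FiniteDimensional ℝ Y]

/-- The KKT solution map of the canonically perturbed problem:
`∇f(x) + ∇g(x)*λ = a` and `λ ∈ N_K(g(x) − b)`. -/
def sKKT (f : X → ℝ) (g : X → Y) (K : Set Y) (a : X) (b : Y) : Set (X × Y) :=
  {p | gradient f p.1 + ContinuousLinearMap.adjoint (fderiv ℝ g p.1) p.2 = a ∧
       p.2 ∈ nCone K (g p.1 - b)}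

/-- The multiplier set map `M(x,a,b)`. -/
def mSet (f : X → ℝ) (g : X → Y) (K : Set Y) (x : X) (a : X) (b : Y) : Set Y :=
  {l | (x, l) ∈ sKKT f g K a b}

/-- The stationary point map `X_KKT(a,b)`. -/
def xKKT (f : X → ℝ) (g : X → Y) (K : Set Y) (a : X) (b : Y) : Set X :=
  {x | ∃ l, (x, l) ∈ sKKT f g K a b}

/-- The Hessian `∇²ₓₓL(x,λ)` of the Lagrangian `L(·,λ)` at `x`. -/
def hessLxx (f : X → ℝ) (g : X → Y) (x : X) (l : Y) : X →L[ℝ] X :=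
  fderiv ℝ (fun u => gradient (fun v => f v + ⟪l, g v⟫) u) x

/-- The multiplier `l0` is noncritical: the only solutions `(ξ,v)` of
`∇²ₓₓL(x̄,λ̄)ξ + ∇g(x̄)*v = 0`, `g'(x̄)ξ − Π_K'(g(x̄)+λ̄; g'(x̄)ξ+v) = 0` have `ξ = 0`. -/
def Noncritical (f : X → ℝ) (g : X → Y) (K : Set Y) (x0 : X) (l0 : Y) : Prop :=
  ∀ (ξ : X) (v : Y),
    hessLxx f g x0 l0 ξ + ContinuousLinearMap.adjoint (fderiv ℝ g x0) v = 0 →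
    HasDirDeriv (projK K) (g x0 + l0) (fderiv ℝ g x0 ξ + v) (fderiv ℝ g x0 ξ) →
    ξ = 0

/-- Strong calmness of `S_KKT` at the origin for `(x̄,λ̄)`. -/
def StrongCalm (f : X → ℝ) (g : X → Y) (K : Set Y) (x0 : X) (l0 : Y) : Prop :=
  ∃ δ ε κ : ℝ, 0 < δ ∧ 0 < ε ∧ 0 < κ ∧
    ∀ (a : X) (b : Y), ‖(a, b)‖ ≤ δ →
      ∀ (x : X) (l : Y), (x, l) ∈ sKKT f g K a b → ‖(x, l) - (x0, l0)‖ ≤ ε →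
        ‖x - x0‖ + infDist l (mSet f g K x0 0 0) ≤ κ * ‖(a, b)‖

/-- Pseudo-isolated calmness of `X_KKT` at the origin for `x̄` (relative to `λ̄`). -/
def PseudoIsolatedCalm (f : X → ℝ) (g : X → Y) (K : Set Y) (x0 : X) (l0 : Y) : Prop :=
  ∃ ε δ κ : ℝ, 0 < ε ∧ 0 < δ ∧ 0 < κ ∧
    ∀ (a : X) (b : Y), ‖(a, b)‖ ≤ δ →
      ∀ (x : X) (l : Y), (x, l) ∈ sKKT f g K a b → ‖(x, l) - (x0, l0)‖ ≤ ε →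
        ‖x - x0‖ ≤ κ * ‖(a, b)‖

/-! ### Helper lemmas -/

theorem aux_diffquot {α E F : Type*} [NormedAddCommGroup E] [NormedSpace ℝ E]
    [NormedAddCommGroup F] [NormedSpace ℝ F] {l : Filter α} {φ : E → F} {φ' : E →L[ℝ] F} {p0 : E}
    (h : HasFDerivAt φ φ' p0) {t : α → ℝ} {p : α → E} {v : E}
    (hp : Tendsto p l (𝓝 p0)) (hq : Tendsto (fun n => (t n)⁻¹ • (p n - p0)) l (𝓝 v)) :
    Tendsto (fun n => (t n)⁻¹ • (φ (p n) - φ p0)) l (𝓝 (φ' v)) := by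
  have h1 : Tendsto (fun n => p n - p0) l (𝓝 0) := by
    simpa using hp.sub_const p0
  have := (hasFDerivWithinAt_univ.2 h).lim (c := fun n => (t n)⁻¹) h1
    (Eventually.of_forall fun _ => mem_univ _) hq
  simpa using this

theorem aux_metricReg {E F : Type*} [NormedAddCommGroup E] [NormedSpace ℝ E] [CompleteSpace E]
    [NormedAddCommGroup F] [NormedSpace ℝ F] [CompleteSpace F]
    {φ : E → F} {φ' : E →L[ℝ] F} {y : E}
    (h : HasStrictFDerivAt φ φ' y) (hs : Function.Surjective φ') :
    ∃ (κ : ℝ) (S : E × F → E), ∀ᶠ p in 𝓝 (y, φ y),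
      φ (S p) = p.2 ∧ ‖S p - p.1‖ ≤ κ * ‖p.2 - φ p.1‖ := by
  have hr : φ'.range = ⊤ := LinearMap.range_eq_top.2 hs
  set R := φ'.nonlinearRightInverseOfSurjective hr with hR
  have hRpos : 0 < R.nnnorm := φ'.nonlinearRightInverseOfSurjective_nnnorm_pos hr
  have hRpos' : (0:ℝ) < R.nnnorm := hRpos
  set c : NNReal := R.nnnorm⁻¹ / 2 with hc
  have hcpos : 0 < c := by positivity
  obtain ⟨s, hsn, happ⟩ := h.approximates_deriv_on_nhds (Or.inr hcpos)
  obtain ⟨r, hr0, hrs⟩ := Metric.mem_nhds_iff.1 hsn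
  have hcc : ((R.nnnorm : ℝ)⁻¹ - c) = (R.nnnorm : ℝ)⁻¹ / 2 := by
    simp [hc]; ring
  have hev : ∀ᶠ p : E × F in 𝓝 (y, φ y), ∃ y', φ y' = p.2 ∧
      ‖y' - p.1‖ ≤ (2 * R.nnnorm) * ‖p.2 - φ p.1‖ := by
    have hφ : ContinuousAt φ y := h.continuousAt
    have h1 : Tendsto (fun p : E × F => ‖p.1 - y‖ + (2 * R.nnnorm) * ‖p.2 - φ p.1‖)
        (𝓝 (y, φ y)) (𝓝 0) := by
      have hc1 : ContinuousAt (fun p : E × F => φ p.1) (y, φ y) :=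
        ContinuousAt.comp (f := Prod.fst) (x := (y, φ y)) hφ continuousAt_fst
      have : ContinuousAt (fun p : E × F => ‖p.1 - y‖ + (2 * R.nnnorm) * ‖p.2 - φ p.1‖)
          (y, φ y) := by
        have h2 : ContinuousAt (fun p : E × F => p.2 - φ p.1) (y, φ y) :=
          continuousAt_snd.sub hc1
        exact ((continuousAt_fst.sub continuousAt_const).norm).add (h2.norm.const_mul _)
      simpa [ContinuousAt] using this
    filter_upwards [h1.eventually_lt_const hr0] with p hp
    have hsub : closedBall p.1 ((2 * R.nnnorm) * ‖p.2 - φ p.1‖) ⊆ s := by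
      refine Subset.trans ?_ hrs
      intro z hz
      rw [mem_closedBall, dist_eq_norm] at hz
      rw [mem_ball, dist_eq_norm]
      calc ‖z - y‖ = ‖(z - p.1) + (p.1 - y)‖ := by congr 1; abel
        _ ≤ ‖z - p.1‖ + ‖p.1 - y‖ := norm_add_le _ _
        _ < r := by linarith
    have := happ.surjOn_closedBall_of_nonlinearRightInverse R
      (b := p.1) (by positivity) hsub
    rw [hcc] at this
    have hmem : p.2 ∈ closedBall (φ p.1) ((R.nnnorm : ℝ)⁻¹ / 2 *
        ((2 * R.nnnorm) * ‖p.2 - φ p.1‖)) := by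
      rw [mem_closedBall, dist_eq_norm]
      apply le_of_eq
      field_simp
    obtain ⟨y', hy', hy2⟩ := this hmem
    refine ⟨y', hy2, ?_⟩
    rwa [mem_closedBall, dist_eq_norm] at hy'
  refine ⟨2 * R.nnnorm, fun p => if hp : ∃ y', φ y' = p.2 ∧
      ‖y' - p.1‖ ≤ (2 * R.nnnorm) * ‖p.2 - φ p.1‖ then hp.choose else 0, ?_⟩
  filter_upwards [hev] with p hp
  rw [dif_pos hp]
  exact hp.choose_spec

theorem aux_curve {α E F : Type*} [NormedAddCommGroup E] [NormedSpace ℝ E] [CompleteSpace E]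
    [NormedAddCommGroup F] [NormedSpace ℝ F] [CompleteSpace F]
    {φ : E → F} {φ' : E →L[ℝ] F} {y : E}
    (h : HasStrictFDerivAt φ φ' y) (hs : Function.Surjective φ')
    {l : Filter α} {t : α → ℝ} (ht : Tendsto t l (𝓝 0)) (ht0 : ∀ᶠ n in l, 0 < t n)
    {w : α → F} {d : E}
    (hw : Tendsto (fun n => (t n)⁻¹ • (w n - φ y)) l (𝓝 (φ' d))) :
    ∃ q : α → E, Tendsto q l (𝓝 y) ∧ Tendsto (fun n => (t n)⁻¹ • (q n - y)) l (𝓝 d) ∧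
      ∀ᶠ n in l, φ (q n) = w n := by
  obtain ⟨κ, S, hS⟩ := aux_metricReg h hs
  have hb : Tendsto (fun n => y + t n • d) l (𝓝 y) := by
    simpa using tendsto_const_nhds.add (ht.smul_const d)
  have hw' : Tendsto w l (𝓝 (φ y)) := by
    have h1 : Tendsto (fun n => φ y + t n • ((t n)⁻¹ • (w n - φ y))) l (𝓝 (φ y)) := by
      simpa using tendsto_const_nhds.add (ht.smul hw)
    refine h1.congr' ?_
    filter_upwards [ht0] with n hn
    rw [smul_inv_smul₀ hn.ne']; abel
  have hbq : Tendsto (fun n => (t n)⁻¹ • ((y + t n • d) - y)) l (𝓝 d) := by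
    refine tendsto_const_nhds.congr' ?_
    filter_upwards [ht0] with n hn
    rw [add_sub_cancel_left, inv_smul_smul₀ hn.ne']
  have hφb := aux_diffquot h.hasFDerivAt hb hbq
  have hev := (hb.prodMk_nhds hw').eventually hS
  have hdiff : Tendsto (fun n => (t n)⁻¹ • (S (y + t n • d, w n) - (y + t n • d))) l (𝓝 0) := by
    have hz : Tendsto (fun n => κ * ‖(t n)⁻¹ • (w n - φ y) -
        (t n)⁻¹ • (φ (y + t n • d) - φ y)‖) l (𝓝 0) := by
      simpa using ((hw.sub hφb).norm.const_mul κ)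
    refine squeeze_zero_norm' ?_ hz
    filter_upwards [hev, ht0] with n hn htn
    rw [← smul_sub, sub_sub_sub_cancel_right, norm_smul, norm_smul]
    have := hn.2
    have hp : 0 ≤ ‖(t n)⁻¹‖ := norm_nonneg _
    calc _ ≤ ‖(t n)⁻¹‖ * (κ * ‖w n - φ (y + t n • d)‖) := by gcongr
      _ = _ := by ring
  have hq : Tendsto (fun n => (t n)⁻¹ • (S (y + t n • d, w n) - y)) l (𝓝 d) := by
    have := hdiff.add hbq
    rw [zero_add] at this
    refine this.congr fun n => ?_
    rw [← smul_add]; congr 1; abel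
  refine ⟨fun n => S (y + t n • d, w n), ?_, hq, ?_⟩
  · have h1 : Tendsto (fun n => y + t n • ((t n)⁻¹ • (S (y + t n • d, w n) - y))) l (𝓝 y) := by
      simpa using tendsto_const_nhds.add (ht.smul hq)
    refine h1.congr' ?_
    filter_upwards [ht0] with n hn
    rw [smul_inv_smul₀ hn.ne']; abel
  · filter_upwards [hev] with n hn using hn.1

theorem aux_proj {E : Type*} [NormedAddCommGroup E] [InnerProductSpace ℝ E] [CompleteSpace E]
    {K : Set E} (hne : K.Nonempty) (hcl : IsClosed K) (hcv : Convex ℝ K) (z : E) :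
    projK K z ∈ K ∧ ∀ y ∈ K, ⟪z - projK K z, y - projK K z⟫ ≤ 0 := by
  have hex : ∃ p, p ∈ K ∧ ∀ y ∈ K, ‖z - p‖ ≤ ‖z - y‖ := by
    obtain ⟨v, hv, hv2⟩ := exists_norm_eq_iInf_of_complete_convex hne hcl.isComplete hcv z
    refine ⟨v, hv, fun y hy => ?_⟩
    rw [hv2]
    exact ciInf_le (f := fun w : K => ‖z - w‖)
      ⟨0, Set.forall_mem_range.2 fun _ => norm_nonneg _⟩ ⟨y, hy⟩
  have hp : projK K z = hex.choose := by
    unfold projK; rw [dif_pos hex]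
  rw [hp]
  obtain ⟨h1, h2⟩ := hex.choose_spec
  refine ⟨h1, ?_⟩
  rw [← norm_eq_iInf_iff_real_inner_le_zero hcv h1]
  have : Nonempty K := hne.to_subtype
  apply le_antisymm
  · exact le_ciInf fun w => h2 w w.2
  · exact ciInf_le (f := fun w : K => ‖z - w‖)
      ⟨0, Set.forall_mem_range.2 fun _ => norm_nonneg _⟩ ⟨_, h1⟩

theorem aux_nonexp {E : Type*} [NormedAddCommGroup E] [InnerProductSpace ℝ E] [CompleteSpace E]
    {K : Set E} (hne : K.Nonempty) (hcl : IsClosed K) (hcv : Convex ℝ K) (z y l : E)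
    (hl : l ∈ nCone K y) : ‖projK K z - y‖ ≤ ‖z - (y + l)‖ := by
  obtain ⟨hp, hp2⟩ := aux_proj hne hcl hcv z
  set p := projK K z
  have h1 := hp2 y hl.1
  have h2 := hl.2 p hp
  have h3 : ⟪z - (y + l), p - y⟫ = ⟪p - y, p - y⟫ - ⟪z - p, y - p⟫ - ⟪l, p - y⟫ := by
    have e1 : z - (y + l) = (p - y) + (z - p) - l := by abel
    have e2 : y - p = -(p - y) := by abel
    rw [e2, inner_neg_right, e1, inner_sub_left, inner_add_left]; ring
  have h4 := real_inner_le_norm (z - (y + l)) (p - y)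
  rw [real_inner_self_eq_norm_sq] at h3
  by_contra hcon
  push Not at hcon
  have : 0 < ‖p - y‖ := lt_of_le_of_lt (norm_nonneg _) hcon
  nlinarith

theorem aux_conePen {E : Type*} [NormedAddCommGroup E] [InnerProductSpace ℝ E]
    [FiniteDimensional ℝ E] {D : Set E} (hcl : IsClosed D) (hcv : Convex ℝ D)
    {μ e η : E} (hμ : ∀ z ∈ D, ⟪μ, z⟫ ≤ 0) (he : e ∈ D) (hμe : ⟪μ, e⟫ = 0)
    (hη : ∀ z ∈ D, ⟪μ, z⟫ = 0 → ⟪η, z⟫ ≤ 0) (hηe : ⟪η, e⟫ = 0) :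
    Tendsto (fun t : ℝ => projK D (t⁻¹ • μ + (e + η))) (𝓝[>] 0) (𝓝 e) := by
  set p := fun t : ℝ => projK D (t⁻¹ • μ + (e + η)) with hpdef
  have hpD : ∀ t, p t ∈ D := fun t => (aux_proj ⟨e, he⟩ hcl hcv _).1
  have hkey : ∀ t : ℝ, ‖p t - e‖ ^ 2 + t⁻¹ * (-⟪μ, p t⟫) ≤ ⟪η, p t⟫ := by
    intro t
    have h := (aux_proj ⟨e, he⟩ hcl hcv (t⁻¹ • μ + (e + η))).2 e he
    change ⟪t⁻¹ • μ + (e + η) - p t, e - p t⟫ ≤ 0 at h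
    have e1 : t⁻¹ • μ + (e + η) - p t = t⁻¹ • μ + η + (e - p t) := by abel
    rw [e1, inner_add_left, inner_add_left, real_inner_self_eq_norm_sq, inner_smul_left,
      inner_sub_right, inner_sub_right, hμe, hηe, norm_sub_rev] at h
    simp at h
    linarith
  have hbd : ∀ t : ℝ, 0 < t → ‖p t - e‖ ≤ ‖η‖ + ‖e‖ + 1 := by
    intro t ht
    have h := hkey t
    have h1 : 0 ≤ t⁻¹ * (-⟪μ, p t⟫) :=
      mul_nonneg (inv_pos.2 ht).le (by linarith [hμ _ (hpD t)])
    have h2 : ⟪η, p t⟫ = ⟪η, p t - e⟫ := by rw [inner_sub_right, hηe, sub_zero]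
    have h3 := real_inner_le_norm η (p t - e)
    by_contra hcon
    push Not at hcon
    nlinarith [norm_nonneg e, norm_nonneg η, norm_nonneg (p t - e)]
  set C := ‖η‖ + ‖e‖ + 1
  refine tendsto_of_subseq_tendsto fun ns hns => ?_
  rw [tendsto_nhdsWithin_iff] at hns
  obtain ⟨hns0, hnspos⟩ := hns
  have hfreq : ∀ᶠ n in atTop, p (ns n) ∈ closedBall e C := by
    filter_upwards [hnspos] with n hn
    rw [mem_closedBall, dist_eq_norm]
    exact hbd _ hn
  obtain ⟨q, -, ms, hms, hq⟩ := (isCompact_closedBall e C).tendsto_subseq' hfreq.frequently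
  refine ⟨ms, ?_⟩
  have hqD : q ∈ D := hcl.mem_of_tendsto hq (Eventually.of_forall fun n => hpD _)
  have hns1 : Tendsto (fun n => ns (ms n)) atTop (𝓝 0) := hns0.comp hms.tendsto_atTop
  have hev := hms.tendsto_atTop.eventually hnspos
  have hμq : ⟪μ, q⟫ = 0 := by
    apply le_antisymm (hμ q hqD)
    have l1 : Tendsto (fun n => ⟪μ, p (ns (ms n))⟫) atTop (𝓝 ⟪μ, q⟫) :=
      tendsto_const_nhds.inner hq
    have l2 : Tendsto (fun n => -(ns (ms n) * ⟪η, p (ns (ms n))⟫)) atTop (𝓝 0) := by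
      have : Tendsto (fun n => ⟪η, p (ns (ms n))⟫) atTop (𝓝 ⟪η, q⟫) :=
        tendsto_const_nhds.inner hq
      simpa using (hns1.mul this).neg
    refine le_of_tendsto_of_tendsto l2 l1 ?_
    filter_upwards [hev] with n hn
    have hn' : 0 < ns (ms n) := hn
    have h := hkey (ns (ms n))
    have h1 : (ns (ms n))⁻¹ * (-⟪μ, p (ns (ms n))⟫) ≤ ⟪η, p (ns (ms n))⟫ := by
      nlinarith [sq_nonneg ‖p (ns (ms n)) - e‖]
    rw [inv_mul_le_iff₀ hn'] at h1
    linarith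
  have hqe : ‖q - e‖ ^ 2 ≤ ⟪η, q⟫ := by
    have l1 : Tendsto (fun n => ‖p (ns (ms n)) - e‖ ^ 2) atTop (𝓝 (‖q - e‖ ^ 2)) :=
      ((hq.sub_const e).norm.pow 2)
    have l2 : Tendsto (fun n => ⟪η, p (ns (ms n))⟫) atTop (𝓝 ⟪η, q⟫) :=
        tendsto_const_nhds.inner hq
    refine le_of_tendsto_of_tendsto l1 l2 ?_
    filter_upwards [hev] with n hn
    have hn' : 0 < ns (ms n) := hn
    have h := hkey (ns (ms n))
    have h1 : 0 ≤ (ns (ms n))⁻¹ * (-⟪μ, p (ns (ms n))⟫) :=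
      mul_nonneg (inv_pos.2 hn').le (by linarith [hμ _ (hpD (ns (ms n)))])
    linarith
  have h0 := hη q hqD hμq
  have : ‖q - e‖ = 0 := by
    have : ‖q - e‖ ^ 2 ≤ 0 := hqe.trans h0
    nlinarith [norm_nonneg (q - e)]
  have hqe' : q = e := by rwa [norm_sub_eq_zero_iff] at this
  rw [← hqe']
  exact hq

theorem aux_clmApply {α E F : Type*} [NormedAddCommGroup E] [NormedSpace ℝ E]
    [NormedAddCommGroup F] [NormedSpace ℝ F] {l : Filter α}
    {T : α → E →L[ℝ] F} {T0 : E →L[ℝ] F} {m : α → E} {m0 : E}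
    (hT : Tendsto T l (𝓝 T0)) (hm : Tendsto m l (𝓝 m0)) :
    Tendsto (fun n => T n (m n)) l (𝓝 (T0 m0)) := by
  have hc : Continuous (fun p : (E →L[ℝ] F) × E => p.1 p.2) :=
    isBoundedBilinearMap_apply.continuous
  have h1 := hc.tendsto (T0, m0)
  have h2 := hT.prodMk_nhds hm
  exact Tendsto.comp h1 h2

theorem aux_adjT {α E F : Type*} [NormedAddCommGroup E] [InnerProductSpace ℝ E] [CompleteSpace E]
    [NormedAddCommGroup F] [InnerProductSpace ℝ F] [CompleteSpace F] {l : Filter α}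
    {T : α → E →L[ℝ] F} {T0 : E →L[ℝ] F} {m : α → F} {m0 : F}
    (hT : Tendsto T l (𝓝 T0)) (hm : Tendsto m l (𝓝 m0)) :
    Tendsto (fun n => ContinuousLinearMap.adjoint (T n) (m n)) l
      (𝓝 (ContinuousLinearMap.adjoint T0 m0)) := by
  have h1 : Tendsto (fun n => ContinuousLinearMap.adjoint (T n)) l
      (𝓝 (ContinuousLinearMap.adjoint T0)) :=
    ((ContinuousLinearMap.adjoint (𝕜 := ℝ) (E := E) (F := F)).continuous.tendsto _).comp hT
  exact aux_clmApply h1 hm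

theorem aux_adj_smul_sub {E F : Type*} [NormedAddCommGroup E] [InnerProductSpace ℝ E]
    [CompleteSpace E] [NormedAddCommGroup F] [InnerProductSpace ℝ F] [CompleteSpace F]
    (s : ℝ) (T T0 : E →L[ℝ] F) (m : F) :
    ContinuousLinearMap.adjoint (s • (T - T0)) m =
      s • (ContinuousLinearMap.adjoint T m - ContinuousLinearMap.adjoint T0 m) := by
  rw [map_smulₛₗ, map_sub]
  simp

theorem aux_lower {E F : Type*} [NormedAddCommGroup E] [InnerProductSpace ℝ E] [CompleteSpace E]
    [NormedAddCommGroup F] [InnerProductSpace ℝ F] [CompleteSpace F] {B : E →L[ℝ] F}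
    (hs : Function.Surjective B) :
    ∃ c : ℝ, 0 < c ∧ ∀ m, c * ‖m‖ ≤ ‖ContinuousLinearMap.adjoint B m‖ := by
  have hr : B.range = ⊤ := LinearMap.range_eq_top.2 hs
  set R := B.nonlinearRightInverseOfSurjective hr with hR
  have hRpos : 0 < R.nnnorm := B.nonlinearRightInverseOfSurjective_nnnorm_pos hr
  have hRpos' : (0:ℝ) < R.nnnorm := hRpos
  refine ⟨(R.nnnorm : ℝ)⁻¹, inv_pos.2 hRpos', fun m => ?_⟩
  rw [inv_mul_le_iff₀ hRpos']
  have h1 : ‖m‖ ^ 2 = ⟪ContinuousLinearMap.adjoint B m, R m⟫ := by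
    rw [ContinuousLinearMap.adjoint_inner_left, R.right_inv, real_inner_self_eq_norm_sq]
  have h2 := real_inner_le_norm (ContinuousLinearMap.adjoint B m) (R m)
  have h3 : ‖R m‖ ≤ R.nnnorm * ‖m‖ := R.bound m
  by_contra hcon
  push Not at hcon
  have h5 : 0 < ‖m‖ := lt_of_le_of_lt (by positivity) hcon
  have h4 : ‖m‖ ^ 2 ≤ ‖ContinuousLinearMap.adjoint B m‖ * (R.nnnorm * ‖m‖) := by
    rw [h1]; exact h2.trans (by gcongr)
  nlinarith

theorem aux_lower_nhds {E F : Type*} [NormedAddCommGroup E] [InnerProductSpace ℝ E]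
    [FiniteDimensional ℝ E]
    [NormedAddCommGroup F] [InnerProductSpace ℝ F] [FiniteDimensional ℝ F] {B : E →L[ℝ] F}
    (hs : Function.Surjective B) :
    ∃ c : ℝ, 0 < c ∧ ∀ᶠ B' : E →L[ℝ] F in 𝓝 B, Function.Surjective B' ∧
      ∀ m, c * ‖m‖ ≤ ‖ContinuousLinearMap.adjoint B' m‖ := by
  obtain ⟨c, hc, hB⟩ := aux_lower hs
  refine ⟨c / 2, by positivity, ?_⟩
  filter_upwards [Metric.ball_mem_nhds B (half_pos hc)] with B' hB'
  rw [mem_ball, dist_eq_norm] at hB'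
  have hlow : ∀ m, c / 2 * ‖m‖ ≤ ‖ContinuousLinearMap.adjoint B' m‖ := by
    intro m
    have h1 : ‖ContinuousLinearMap.adjoint (B' - B) m‖ ≤ c / 2 * ‖m‖ := by
      refine (ContinuousLinearMap.le_opNorm _ _).trans ?_
      rw [LinearIsometryEquiv.norm_map]
      gcongr
    have h2 : ContinuousLinearMap.adjoint B m = ContinuousLinearMap.adjoint B' m
        - ContinuousLinearMap.adjoint (B' - B) m := by
      rw [map_sub]; simp
    have h3 := hB m
    rw [h2] at h3
    have h4 := norm_sub_le (ContinuousLinearMap.adjoint B' m)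
      (ContinuousLinearMap.adjoint (B' - B) m)
    linarith
  refine ⟨?_, hlow⟩
  have h1 : B'.rangeᗮ = ⊥ := by
    rw [ContinuousLinearMap.orthogonal_range, LinearMap.ker_eq_bot']
    intro m hm
    have h2 := hlow m
    have hm' : ContinuousLinearMap.adjoint B' m = 0 := hm
    rw [hm', norm_zero] at h2
    have : ‖m‖ ≤ 0 := by nlinarith [norm_nonneg m]
    simpa using this
  rw [Submodule.orthogonal_eq_bot_iff] at h1
  exact LinearMap.range_eq_top.1 h1

theorem aux_mem_range_adj {E F : Type*} [NormedAddCommGroup E] [InnerProductSpace ℝ E]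
    [FiniteDimensional ℝ E]
    [NormedAddCommGroup F] [InnerProductSpace ℝ F] [FiniteDimensional ℝ F] (B : E →L[ℝ] F)
    (l : E) (h : ∀ d, B d = 0 → ⟪l, d⟫ ≤ 0) : ∃ m, ContinuousLinearMap.adjoint B m = l := by
  have h1 : l ∈ B.kerᗮ := by
    rw [Submodule.mem_orthogonal']
    intro d hd
    have hd' : B d = 0 := hd
    apply le_antisymm (h d hd')
    have := h (-d) (by simp [hd'])
    rw [inner_neg_right] at this
    linarith
  rw [ContinuousLinearMap.orthogonal_ker] at h1
  have h2 : IsClosed (((ContinuousLinearMap.adjoint B).range : Submodule ℝ E) : Set E) :=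
    Submodule.closed_of_finiteDimensional _
  rw [h2.submodule_topologicalClosure_eq] at h1
  exact h1

theorem aux_pos_filter : (∀ᶠ t : ℝ in 𝓝[>] (0:ℝ), 0 < t) := eventually_mem_nhdsWithin

theorem aux_pos_tendsto : Tendsto (fun t : ℝ => t) (𝓝[>] (0:ℝ)) (𝓝 0) :=
  tendsto_nhdsWithin_of_tendsto_nhds tendsto_id

theorem aux_normal {E F : Type*} [NormedAddCommGroup E] [InnerProductSpace ℝ E]
    [FiniteDimensional ℝ E]
    [NormedAddCommGroup F] [InnerProductSpace ℝ F] [FiniteDimensional ℝ F] {B : E →L[ℝ] F}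
    {φ : E → F} {y : E} (h : HasStrictFDerivAt φ B y) (hs : Function.Surjective B)
    {K U : Set E} {D : Set F} (hU : IsOpen U) (hy : y ∈ U) (hK : K ∩ U = {y ∈ U | φ y ∈ D})
    (hD : Convex ℝ D) {l : E} (hl : l ∈ nCone K y) :
    ∃ m ∈ nCone D (φ y), ContinuousLinearMap.adjoint B m = l := by
  have hyD : φ y ∈ D := by
    have : y ∈ K ∩ U := ⟨hl.1, hy⟩
    rw [hK] at this; exact this.2
  have key : ∀ d, φ y + B d ∈ D → ⟪l, d⟫ ≤ 0 := by
    intro d hd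
    have hw : Tendsto (fun t : ℝ => t⁻¹ • ((φ y + t • B d) - φ y)) (𝓝[>] 0) (𝓝 (B d)) := by
      refine tendsto_const_nhds.congr' ?_
      filter_upwards [aux_pos_filter] with t ht
      rw [add_sub_cancel_left, inv_smul_smul₀ ht.ne']
    obtain ⟨q, hq, hqd, hqe⟩ := aux_curve h hs aux_pos_tendsto aux_pos_filter hw
    have hlim : Tendsto (fun t : ℝ => ⟪l, t⁻¹ • (q t - y)⟫) (𝓝[>] 0) (𝓝 ⟪l, d⟫) :=
      tendsto_const_nhds.inner hqd
    refine le_of_tendsto hlim ?_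
    filter_upwards [aux_pos_filter, hqe, hq.eventually (hU.mem_nhds hy),
      aux_pos_tendsto.eventually_lt_const one_pos] with t ht hqt hqU ht1
    have hmem : φ (q t) ∈ D := by
      rw [hqt]
      have := hD hyD hd (a := 1 - t) (b := t) (by linarith) ht.le (by ring)
      convert this using 1
      rw [smul_add, ← add_assoc, ← add_smul]; simp
    have hqK : q t ∈ K := by
      have : q t ∈ K ∩ U := by rw [hK]; exact ⟨hqU, hmem⟩
      exact this.1
    rw [inner_smul_right]
    exact mul_nonpos_of_nonneg_of_nonpos (inv_pos.2 ht).le (hl.2 _ hqK)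
  obtain ⟨m, hm⟩ := aux_mem_range_adj B l fun d hd => key d (by rw [hd, add_zero]; exact hyD)
  refine ⟨m, ⟨hyD, fun z hz => ?_⟩, hm⟩
  obtain ⟨d, hd⟩ := hs (z - φ y)
  rw [← hd, ← ContinuousLinearMap.adjoint_inner_left, hm]
  apply key
  rw [hd]; simpa using hz

theorem aux_normal_rev {E F : Type*} [NormedAddCommGroup E] [InnerProductSpace ℝ E]
    [FiniteDimensional ℝ E]
    [NormedAddCommGroup F] [InnerProductSpace ℝ F] [FiniteDimensional ℝ F] {B : E →L[ℝ] F}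
    {φ : E → F} {y : E} (h : HasFDerivAt φ B y)
    {K U : Set E} {D : Set F} (hU : IsOpen U) (hy : y ∈ U) (hK : K ∩ U = {y ∈ U | φ y ∈ D})
    (hKcv : Convex ℝ K) {m : F} (hm : m ∈ nCone D (φ y)) :
    ContinuousLinearMap.adjoint B m ∈ nCone K y := by
  have hyK : y ∈ K := by
    have : y ∈ K ∩ U := by rw [hK]; exact ⟨hy, hm.1⟩
    exact this.1
  refine ⟨hyK, fun z hz => ?_⟩
  rw [ContinuousLinearMap.adjoint_inner_left]
  have hq : Tendsto (fun t : ℝ => y + t • (z - y)) (𝓝[>] 0) (𝓝 y) := by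
    simpa using tendsto_const_nhds.add (aux_pos_tendsto.smul_const (z - y))
  have hqd : Tendsto (fun t : ℝ => t⁻¹ • ((y + t • (z - y)) - y)) (𝓝[>] 0) (𝓝 (z - y)) := by
    refine tendsto_const_nhds.congr' ?_
    filter_upwards [aux_pos_filter] with t ht
    rw [add_sub_cancel_left, inv_smul_smul₀ ht.ne']
  have hlim : Tendsto (fun t : ℝ => ⟪m, t⁻¹ • (φ (y + t • (z - y)) - φ y)⟫) (𝓝[>] 0)
      (𝓝 ⟪m, B (z - y)⟫) := tendsto_const_nhds.inner (aux_diffquot h hq hqd)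
  refine le_of_tendsto hlim ?_
  filter_upwards [aux_pos_filter, hq.eventually (hU.mem_nhds hy),
      aux_pos_tendsto.eventually_lt_const one_pos] with t ht hqU ht1
  have hqK : y + t • (z - y) ∈ K := hKcv.add_smul_sub_mem hyK hz ⟨ht.le, ht1.le⟩
  have hqD : φ (y + t • (z - y)) ∈ D := by
    have : y + t • (z - y) ∈ K ∩ U := ⟨hqK, hqU⟩
    rw [hK] at this; exact this.2
  rw [inner_smul_right]
  exact mul_nonpos_of_nonneg_of_nonpos (inv_pos.2 ht).le (hm.2 _ hqD)

theorem aux_tangent {E F : Type*} [NormedAddCommGroup E] [InnerProductSpace ℝ E]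
    [FiniteDimensional ℝ E]
    [NormedAddCommGroup F] [InnerProductSpace ℝ F] [FiniteDimensional ℝ F] {B : E →L[ℝ] F}
    {φ : E → F} {y : E} (h : HasStrictFDerivAt φ B y) (hs : Function.Surjective B)
    {K U : Set E} {D : Set F} (hU : IsOpen U) (hy : y ∈ U) (hK : K ∩ U = {y ∈ U | φ y ∈ D})
    (hD : PointedClosedConvexCone D) (h0 : φ y = 0) (d : E) :
    d ∈ contCone K y ↔ B d ∈ D := by
  obtain ⟨hcl, hcv, hcone, -⟩ := hD
  constructor
  · rintro ⟨t, v, ht, ht0, hv, hmem⟩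
    have hq : Tendsto (fun n => y + t n • v n) atTop (𝓝 y) := by
      simpa using tendsto_const_nhds.add (ht0.smul hv)
    have hqd : Tendsto (fun n => (t n)⁻¹ • ((y + t n • v n) - y)) atTop (𝓝 d) := by
      refine hv.congr fun n => ?_
      rw [add_sub_cancel_left, inv_smul_smul₀ (ht n).ne']
    have hlim := aux_diffquot h.hasFDerivAt hq hqd
    refine hcl.mem_of_tendsto hlim ?_
    filter_upwards [hq.eventually (hU.mem_nhds hy)] with n hn
    have : y + t n • v n ∈ K ∩ U := ⟨hmem n, hn⟩
    rw [hK] at this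
    rw [h0, sub_zero]
    exact hcone _ (inv_pos.2 (ht n)).le _ this.2
  · intro hd
    have hw : Tendsto (fun t : ℝ => t⁻¹ • (t • B d - φ y)) (𝓝[>] 0) (𝓝 (B d)) := by
      refine tendsto_const_nhds.congr' ?_
      filter_upwards [aux_pos_filter] with t ht
      rw [h0, sub_zero, inv_smul_smul₀ ht.ne']
    obtain ⟨q, hq, hqd, hqe⟩ := aux_curve h hs aux_pos_tendsto aux_pos_filter hw
    have hev : ∀ᶠ t : ℝ in 𝓝[>] 0, 0 < t ∧ q t ∈ K := by
      filter_upwards [aux_pos_filter, hqe, hq.eventually (hU.mem_nhds hy)] with t ht hqt hqU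
      have : q t ∈ K ∩ U := by
        rw [hK]; exact ⟨hqU, by rw [hqt]; exact hcone t ht.le _ hd⟩
      exact ⟨ht, this.1⟩
    obtain ⟨s, hs1⟩ := exists_seq_tendsto (𝓝[>] (0:ℝ))
    obtain ⟨N, hN⟩ := eventually_atTop.1 (hs1.eventually hev)
    have hs2 : Tendsto (fun n => s (n + N)) atTop (𝓝[>] 0) := hs1.comp (tendsto_add_atTop_nat N)
    refine ⟨fun n => s (n + N), fun n => (s (n + N))⁻¹ • (q (s (n + N)) - y), ?_, ?_, ?_, ?_⟩
    · exact fun n => (hN (n + N) (by omega)).1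
    · exact aux_pos_tendsto.comp hs2
    · exact hqd.comp hs2
    · intro n
      have := hN (n + N) (by omega)
      rw [smul_inv_smul₀ this.1.ne']
      simpa using this.2

theorem aux_dirDeriv {E F : Type*} [NormedAddCommGroup E] [InnerProductSpace ℝ E]
    [FiniteDimensional ℝ E]
    [NormedAddCommGroup F] [InnerProductSpace ℝ F] [FiniteDimensional ℝ F]
    {φ : E → F} {y : E} (h : HasStrictFDerivAt φ (fderiv ℝ φ y) y)
    (hs : Function.Surjective (fderiv ℝ φ y))
    {B2 : E →L[ℝ] E →L[ℝ] F} (h2 : HasFDerivAt (fderiv ℝ φ) B2 y)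
    (hdiff : ∀ᶠ z in 𝓝 y, DifferentiableAt ℝ φ z)
    {K U : Set E} {D : Set F} (hU : IsOpen U) (hy : y ∈ U) (hK : K ∩ U = {y ∈ U | φ y ∈ D})
    (hKne : K.Nonempty) (hKcl : IsClosed K) (hKcv : Convex ℝ K)
    (hD : PointedClosedConvexCone D) (h0 : φ y = 0) {μ η : F} {d : E}
    (hμ : ∀ z ∈ D, ⟪μ, z⟫ ≤ 0) (he : fderiv ℝ φ y d ∈ D) (hμe : ⟪μ, fderiv ℝ φ y d⟫ = 0)
    (hη : ∀ z ∈ D, ⟪μ, z⟫ = 0 → ⟪η, z⟫ ≤ 0) (hηe : ⟪η, fderiv ℝ φ y d⟫ = 0) :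
    HasDirDeriv (projK K) (y + ContinuousLinearMap.adjoint (fderiv ℝ φ y) μ)
      (d + (ContinuousLinearMap.adjoint (fderiv ℝ φ y) η + ContinuousLinearMap.adjoint (B2 d) μ))
      d := by
  obtain ⟨hcl, hcv, hcone, -⟩ := hD
  set B := fderiv ℝ φ y with hB
  set e := B d with hedef
  set p := fun t : ℝ => projK D (t⁻¹ • μ + (e + η)) with hpdef
  have hp : Tendsto p (𝓝[>] 0) (𝓝 e) := aux_conePen hcl hcv hμ he hμe hη hηe
  have hpD : ∀ t, p t ∈ D := fun t => (aux_proj ⟨e, he⟩ hcl hcv _).1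
  have hpN : ∀ t, ∀ z ∈ D, ⟪t⁻¹ • μ + (e + η) - p t, z - p t⟫ ≤ 0 :=
    fun t => (aux_proj ⟨e, he⟩ hcl hcv _).2
  have hw : Tendsto (fun t : ℝ => t⁻¹ • (t • p t - φ y)) (𝓝[>] 0) (𝓝 (B d)) := by
    refine hp.congr' ?_
    filter_upwards [aux_pos_filter] with t ht
    rw [h0, sub_zero, inv_smul_smul₀ ht.ne']
  obtain ⟨q, hq, hqd, hqe⟩ := aux_curve h hs aux_pos_tendsto aux_pos_filter hw
  set m := fun t : ℝ => μ + t • (e + η - p t) with hm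
  have hmq : Tendsto (fun t => e + η - p t) (𝓝[>] 0) (𝓝 η) := by
    simpa using (tendsto_const_nhds (x := e + η)).sub hp
  have hm0 : Tendsto m (𝓝[>] 0) (𝓝 μ) := by
    simpa using (tendsto_const_nhds (x := μ)).add (aux_pos_tendsto.smul hmq)
  set L := fun t : ℝ => ContinuousLinearMap.adjoint (fderiv ℝ φ (q t)) (m t) with hL
  have hLq : Tendsto (fun t : ℝ => t⁻¹ • (L t - ContinuousLinearMap.adjoint B μ)) (𝓝[>] 0)
      (𝓝 (ContinuousLinearMap.adjoint B η + ContinuousLinearMap.adjoint (B2 d) μ)) := by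
    have l1 := aux_adjT (aux_diffquot h2 hq hqd) hm0
    have l2 := aux_adjT (tendsto_const_nhds (x := B)) hmq
    refine (l2.add l1).congr' ?_
    filter_upwards [aux_pos_filter] with t ht
    rw [aux_adj_smul_sub]
    have : ContinuousLinearMap.adjoint B (e + η - p t) =
        t⁻¹ • (ContinuousLinearMap.adjoint B (m t) - ContinuousLinearMap.adjoint B μ) := by
      rw [← map_sub, hm]
      simp only [add_sub_cancel_left]
      rw [map_smul, inv_smul_smul₀ ht.ne']
    rw [this, ← smul_add]
    congr 1
    abel
  have hLN : ∀ᶠ t in 𝓝[>] (0:ℝ), L t ∈ nCone K (q t) := by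
    filter_upwards [aux_pos_filter, hqe, hq.eventually (hU.mem_nhds hy), hq.eventually hdiff]
      with t ht hqt hqU hqdiff
    refine aux_normal_rev hqdiff.hasFDerivAt hU hqU hK hKcv ?_
    rw [hqt]
    refine ⟨hcone t ht.le _ (hpD t), fun z hz => ?_⟩
    have h1 := hpN t (t⁻¹ • z) (hcone _ (inv_pos.2 ht).le _ hz)
    have e1 : m t = t • (t⁻¹ • μ + (e + η) - p t) := by
      rw [hm]; simp only [smul_sub, smul_add, smul_inv_smul₀ ht.ne']; abel
    have e2 : z - t • p t = t • (t⁻¹ • z - p t) := by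
      rw [smul_sub, smul_inv_smul₀ ht.ne']
    rw [e1, e2, inner_smul_left, inner_smul_right]
    simp only [conj_trivial]
    have : 0 < t * t := by positivity
    nlinarith
  have hl0 : ContinuousLinearMap.adjoint B μ ∈ nCone K y := by
    refine aux_normal_rev h.hasFDerivAt hU hy hK hKcv ?_
    rw [h0]
    refine ⟨?_, fun z hz => by simpa using hμ z hz⟩
    simpa using hcone 0 le_rfl _ he
  have hpz : projK K (y + ContinuousLinearMap.adjoint B μ) = y := by
    have := aux_nonexp hKne hKcl hKcv (y + ContinuousLinearMap.adjoint B μ) y _ hl0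
    rw [sub_self, norm_zero] at this
    rw [← sub_eq_zero, ← norm_le_zero_iff]; exact this
  unfold HasDirDeriv
  rw [hpz]
  set v := ContinuousLinearMap.adjoint B η + ContinuousLinearMap.adjoint (B2 d) μ
  set z0 := y + ContinuousLinearMap.adjoint B μ
  have hdf : Tendsto (fun t : ℝ => t⁻¹ • (projK K (z0 + t • (d + v)) - y) - t⁻¹ • (q t - y))
      (𝓝[>] 0) (𝓝 0) := by
    have hz : Tendsto (fun t : ℝ => ‖(d + v) - t⁻¹ • (q t - y) -
        t⁻¹ • (L t - ContinuousLinearMap.adjoint B μ)‖) (𝓝[>] 0) (𝓝 0) := by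
      have := (((tendsto_const_nhds (x := d + v)).sub hqd).sub hLq).norm
      simpa [v] using this
    refine squeeze_zero_norm' ?_ hz
    filter_upwards [aux_pos_filter, hLN] with t ht htL
    have h1 := aux_nonexp hKne hKcl hKcv (z0 + t • (d + v)) (q t) _ htL
    have e1 : (d + v) - t⁻¹ • (q t - y) - t⁻¹ • (L t - ContinuousLinearMap.adjoint B μ)
        = t⁻¹ • (z0 + t • (d + v) - (q t + L t)) := by
      have : d + v = t⁻¹ • (t • (d + v)) := by rw [inv_smul_smul₀ ht.ne']
      conv_lhs => rw [this]
      rw [← smul_sub, ← smul_sub]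
      congr 1
      simp only [z0]; abel
    rw [e1, ← smul_sub, sub_sub_sub_cancel_right, norm_smul, norm_smul]
    gcongr
  have := hdf.add hqd
  simpa using this

theorem aux_gradQuad {E F : Type*} [NormedAddCommGroup E] [InnerProductSpace ℝ E]
    [FiniteDimensional ℝ E]
    [NormedAddCommGroup F] [InnerProductSpace ℝ F] [FiniteDimensional ℝ F]
    (B2 : E →L[ℝ] E →L[ℝ] F) (hsym : ∀ u w, B2 u w = B2 w u) (μ : F) (d : E) :
    (1 / 2 : ℝ) • gradient (fun h : E => ⟪μ, B2 h h⟫) d = ContinuousLinearMap.adjoint (B2 d) μ := by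
  have hd : HasFDerivAt (fun h : E => B2 h h) (B2 d + B2.flip d) d := by
    have h1 : HasFDerivAt (fun h : E => B2 h) B2 d := B2.hasFDerivAt
    have h2 := h1.clm_apply (hasFDerivAt_id d)
    have h3 : B2 d + B2.flip d = B2 d ∘SL ContinuousLinearMap.id ℝ E + B2.flip (id d) := by
      ext w; simp
    rw [h3]; exact h2
  have hd2 : HasFDerivAt (fun h : E => ⟪μ, B2 h h⟫) ((innerSL ℝ μ).comp (B2 d + B2.flip d)) d :=
    (innerSL ℝ μ).hasFDerivAt.comp d hd
  have hg : HasGradientAt (fun h : E => ⟪μ, B2 h h⟫)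
      ((2 : ℝ) • ContinuousLinearMap.adjoint (B2 d) μ) d := by
    rw [hasGradientAt_iff_hasFDerivAt]
    have h3 : InnerProductSpace.toDual ℝ E ((2 : ℝ) • ContinuousLinearMap.adjoint (B2 d) μ) =
        (innerSL ℝ μ).comp (B2 d + B2.flip d) := by
      ext w
      rw [InnerProductSpace.toDual_apply_apply, real_inner_smul_left,
        ContinuousLinearMap.adjoint_inner_left]
      simp [inner_add_right, hsym w d]
      ring
    rw [h3]; exact hd2
  rw [hg.gradient, smul_smul]
  norm_num

theorem aux_gradL {f : X → ℝ} {g : X → Y} (hf : ContDiff ℝ 2 f) (hg : ContDiff ℝ 2 g)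
    (l0 : Y) (u : X) :
    gradient (fun v => f v + ⟪l0, g v⟫) u =
      gradient f u + ContinuousLinearMap.adjoint (fderiv ℝ g u) l0 := by
  apply HasGradientAt.gradient
  rw [hasGradientAt_iff_hasFDerivAt]
  have h1 : HasFDerivAt f (fderiv ℝ f u) u := (hf.differentiable (by norm_num) u).hasFDerivAt
  have h2 : HasFDerivAt g (fderiv ℝ g u) u := (hg.differentiable (by norm_num) u).hasFDerivAt
  have h3 : HasFDerivAt (fun v => f v + ⟪l0, g v⟫)
      (fderiv ℝ f u + (innerSL ℝ l0).comp (fderiv ℝ g u)) u :=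
    h1.add ((innerSL ℝ l0).hasFDerivAt.comp u h2)
  have h4 : InnerProductSpace.toDual ℝ X
      (gradient f u + ContinuousLinearMap.adjoint (fderiv ℝ g u) l0) =
      fderiv ℝ f u + (innerSL ℝ l0).comp (fderiv ℝ g u) := by
    rw [map_add, toDual_gradient]
    congr 1
    ext w
    simp [ContinuousLinearMap.adjoint_inner_left]
  rw [h4]; exact h3

theorem aux_hess {f : X → ℝ} {g : X → Y} (hf : ContDiff ℝ 2 f) (hg : ContDiff ℝ 2 g)
    (l0 : Y) (x0 : X) :
    HasFDerivAt (fun u => gradient f u + ContinuousLinearMap.adjoint (fderiv ℝ g u) l0)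
      (hessLxx f g x0 l0) x0 := by
  have he : (fun u => gradient f u + ContinuousLinearMap.adjoint (fderiv ℝ g u) l0) =
      fun u => gradient (fun v => f v + ⟪l0, g v⟫) u := by
    ext1 u; rw [aux_gradL hf hg]
  rw [he]
  unfold hessLxx
  apply DifferentiableAt.hasFDerivAt
  have hL : ContDiff ℝ 2 (fun v => f v + ⟪l0, g v⟫) := hf.add (contDiff_const.inner ℝ hg)
  have h1 : ContDiff ℝ 1 (fderiv ℝ (fun v => f v + ⟪l0, g v⟫)) :=
    hL.fderiv_right (by norm_num)
  have h2 : DifferentiableAt ℝ (fderiv ℝ (fun v => f v + ⟪l0, g v⟫)) x0 :=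
    h1.differentiable (by norm_num) x0
  have h3 : DifferentiableAt ℝ (fun u => (InnerProductSpace.toDual ℝ X).symm
      (fderiv ℝ (fun v => f v + ⟪l0, g v⟫) u)) x0 :=
    ((InnerProductSpace.toDual ℝ X).symm.toContinuousLinearEquiv.toContinuousLinearMap
      : StrongDual ℝ X →L[ℝ] X).differentiableAt.comp x0 h2
  exact h3

theorem aux_seq {f : X → ℝ} {g : X → Y} {K : Set Y} {x0 : X} {l0 : Y}
    (hne : ¬ PseudoIsolatedCalm f g K x0 l0) :
    ∃ (t : ℕ → ℝ) (a x : ℕ → X) (b l : ℕ → Y) (ξ : X), ξ ≠ 0 ∧ (∀ n, 0 < t n) ∧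
      Tendsto t atTop (𝓝 0) ∧ Tendsto x atTop (𝓝 x0) ∧ Tendsto l atTop (𝓝 l0) ∧
      Tendsto (fun n => (t n)⁻¹ • (x n - x0)) atTop (𝓝 ξ) ∧
      Tendsto (fun n => (t n)⁻¹ • a n) atTop (𝓝 0) ∧
      Tendsto (fun n => (t n)⁻¹ • b n) atTop (𝓝 0) ∧
      ∀ n, (x n, l n) ∈ sKKT f g K (a n) (b n) := by
  unfold PseudoIsolatedCalm at hne
  push Not at hne
  have hp : ∀ n : ℕ, (0:ℝ) < 1 / ((n:ℝ) + 1) := fun n => by positivity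
  have hp' : ∀ n : ℕ, (0:ℝ) < (n:ℝ) + 1 := fun n => by positivity
  choose a b hab x l hk hxl hgt using fun n : ℕ => hne _ _ _ (hp n) (hp n) (hp' n)
  have hlim : Tendsto (fun n : ℕ => 1 / ((n:ℝ) + 1)) atTop (𝓝 0) :=
    tendsto_one_div_add_atTop_nhds_zero_nat
  have hpos : ∀ n, 0 < ‖x n - x0‖ := fun n =>
    lt_of_le_of_lt (mul_nonneg (hp' n).le (norm_nonneg _)) (hgt n)
  have hx : Tendsto (fun n => x n - x0) atTop (𝓝 0) :=
    squeeze_zero_norm (fun n => (norm_fst_le ((x n, l n) - (x0, l0))).trans (hxl n)) hlim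
  have hl : Tendsto (fun n => l n - l0) atTop (𝓝 0) :=
    squeeze_zero_norm (fun n => (norm_snd_le ((x n, l n) - (x0, l0))).trans (hxl n)) hlim
  have habn : ∀ n, ‖x n - x0‖⁻¹ * ‖(a n, b n)‖ ≤ 1 / ((n:ℝ) + 1) := by
    intro n
    rw [inv_mul_le_iff₀ (hpos n), mul_one_div, le_div_iff₀ (hp' n)]
    have := hgt n
    linarith
  have ha : Tendsto (fun n => ‖x n - x0‖⁻¹ • a n) atTop (𝓝 0) := by
    refine squeeze_zero_norm (fun n => le_trans ?_ (habn n)) hlim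
    rw [norm_smul, norm_inv, norm_norm]
    gcongr
    exact norm_fst_le (a n, b n)
  have hb : Tendsto (fun n => ‖x n - x0‖⁻¹ • b n) atTop (𝓝 0) := by
    refine squeeze_zero_norm (fun n => le_trans ?_ (habn n)) hlim
    rw [norm_smul, norm_inv, norm_norm]
    gcongr
    exact norm_snd_le (a n, b n)
  have hsph : ∀ n, ‖x n - x0‖⁻¹ • (x n - x0) ∈ sphere (0 : X) 1 := by
    intro n
    rw [mem_sphere_zero_iff_norm, norm_smul, norm_inv, norm_norm, inv_mul_cancel₀ (hpos n).ne']
  obtain ⟨ξ, hξ, ψ, hψ, hξl⟩ := (isCompact_sphere (0 : X) 1).tendsto_subseq hsph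
  have hψ' := hψ.tendsto_atTop
  refine ⟨fun n => ‖x (ψ n) - x0‖, a ∘ ψ, x ∘ ψ, b ∘ ψ, l ∘ ψ, ξ, ?_, fun n => hpos _, ?_, ?_, ?_,
    hξl, ha.comp hψ', hb.comp hψ', fun n => hk _⟩
  · rintro rfl
    simp at hξ
  · have h5 : Tendsto (fun n => ‖x n - x0‖) atTop (𝓝 0) := by simpa using hx.norm
    exact h5.comp hψ'
  · exact (tendsto_sub_nhds_zero_iff.1 hx).comp hψ'
  · exact (tendsto_sub_nhds_zero_iff.1 hl).comp hψ'

/-- Proposition 4.2: given the `C²`-reduction data `(U, D, Ξ)` of `K`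
at `ȳ = g(x̄)` and the multiplier `μ̄ ∈ N_D(Ξ(ȳ))` with `λ̄ = ∇Ξ(ȳ)*μ̄` defining
`Υ(h) = ⟪μ̄, Ξ''(ȳ)(h,h)⟫`, if `⟪g'(x̄)ξ, ζ⟫ ≥ 0` for all `(ξ,ζ) ∈ Σ(x̄,λ̄) ∩ Γ(x̄,λ̄)` and
`∇g(x̄)*[C_K(g(x̄),λ̄)]°` is closed, then noncriticality of `λ̄` implies the
pseudo-isolated calmness of `X_KKT` at the origin for `x̄`. -/
theorem stmt_11 (f : X → ℝ) (g : X → Y) (K : Set Y)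
    (hf : ContDiff ℝ 2 f) (hg : ContDiff ℝ 2 g)
    (hKne : K.Nonempty) (hKcl : IsClosed K) (hKcv : Convex ℝ K)
    (hKred : C2ConeReducible K)
    (x0 : X) (l0 : Y) (hKKT : (x0, l0) ∈ sKKT f g K 0 0)
    (m : ℕ) (U : Set Y) (D : Set (EuclideanSpace ℝ (Fin m)))
    (Ξ : Y → EuclideanSpace ℝ (Fin m))
    (hU : IsOpen U) (hyU : g x0 ∈ U) (hD : PointedClosedConvexCone D)
    (hΞ : ContDiffOn ℝ 2 Ξ U) (hΞ0 : Ξ (g x0) = 0)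
    (hsurj : Function.Surjective (fderiv ℝ Ξ (g x0)))
    (hredU : K ∩ U = {y ∈ U | Ξ y ∈ D})
    (μ : EuclideanSpace ℝ (Fin m)) (hμ : μ ∈ nCone D (Ξ (g x0)))
    (hlμ : l0 = ContinuousLinearMap.adjoint (fderiv ℝ Ξ (g x0)) μ)
    (hpos : ∀ (ξ : X) (ζ : Y),
      hessLxx f g x0 l0 ξ + ContinuousLinearMap.adjoint (fderiv ℝ g x0)
          (ζ + (1 / 2 : ℝ) •
            gradient (fun h : Y => ⟪μ, fderiv ℝ (fderiv ℝ Ξ) (g x0) h h⟫)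
              (fderiv ℝ g x0 ξ)) = 0 →
      fderiv ℝ g x0 ξ ∈ criticalCone K (g x0) l0 →
      ζ ∈ negPolar (criticalCone K (g x0) l0) →
      0 ≤ ⟪fderiv ℝ g x0 ξ, ζ⟫)
    (hclosed : IsClosed (ContinuousLinearMap.adjoint (fderiv ℝ g x0) ''
        negPolar (criticalCone K (g x0) l0)))
    (hnc : Noncritical f g K x0 l0) :
    PseudoIsolatedCalm f g K x0 l0 := by
  by_contra hcon
  obtain ⟨t, a, x, b, l, ξ, hξ, ht, ht0, hx, hl, hxq, haq, hbq, hk⟩ := aux_seq hcon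
  apply hξ
  -- reduction data
  set B := fderiv ℝ Ξ (g x0) with hB
  set B2 := fderiv ℝ (fderiv ℝ Ξ) (g x0) with hB2
  set A := fderiv ℝ g x0 with hA
  have hCD : ∀ y ∈ U, ContDiffAt ℝ 2 Ξ y := fun y hy => hΞ.contDiffAt (hU.mem_nhds hy)
  have hst : ∀ y ∈ U, HasStrictFDerivAt Ξ (fderiv ℝ Ξ y) y := fun y hy =>
    (hCD y hy).hasStrictFDerivAt (by norm_num)
  have hder1 : ContDiffAt ℝ 1 (fderiv ℝ Ξ) (g x0) := (hCD _ hyU).fderiv_right (by norm_num)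
  have hder : HasFDerivAt (fderiv ℝ Ξ) B2 (g x0) :=
    (hder1.differentiableAt (by norm_num)).hasFDerivAt
  have hsym : ∀ u w, B2 u w = B2 w u := fun u w =>
    (hCD _ hyU).isSymmSndFDerivAt (by simp) u w
  have hdiffev : ∀ᶠ z in 𝓝 (g x0), DifferentiableAt ℝ Ξ z := by
    filter_upwards [hU.mem_nhds hyU] with z hz
    exact (hst z hz).hasFDerivAt.differentiableAt
  have hDcl := hD.1
  have hDcv := hD.2.1
  have hDcone := hD.2.2.1
  have hnD : ∀ z m', m' ∈ nCone D z → (∀ w ∈ D, ⟪m', w⟫ ≤ 0) ∧ ⟪m', z⟫ = 0 := by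
    intro z m' hm'
    have hz0 : ⟪m', z⟫ = 0 := by
      apply le_antisymm
      · have := hm'.2 ((2:ℝ) • z) (hDcone 2 (by norm_num) z hm'.1)
        rw [two_smul, add_sub_cancel_right] at this
        exact this
      · have := hm'.2 ((0:ℝ) • z) (hDcone 0 le_rfl z hm'.1)
        rw [zero_smul, zero_sub, inner_neg_right] at this
        linarith
    refine ⟨fun w hw => ?_, hz0⟩
    have := hm'.2 w hw
    rw [inner_sub_right, hz0] at this
    linarith
  have hμD : ∀ w ∈ D, ⟪μ, w⟫ ≤ 0 := (hnD _ _ hμ).1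
  have hcrit : ∀ d, d ∈ criticalCone K (g x0) l0 ↔ (B d ∈ D ∧ ⟪μ, B d⟫ = 0) := by
    intro d
    unfold criticalCone
    rw [mem_inter_iff, aux_tangent (hst _ hyU) hsurj hU hyU hredU hD hΞ0, Set.mem_ofPred_eq, hlμ,
      ContinuousLinearMap.adjoint_inner_left]
  -- the perturbed points
  have hgd : HasFDerivAt g A x0 := (hg.differentiable (by norm_num) x0).hasFDerivAt
  have hb0 : Tendsto b atTop (𝓝 0) := by
    have : Tendsto (fun n => t n • ((t n)⁻¹ • b n)) atTop (𝓝 0) := by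
      simpa using ht0.smul hbq
    refine this.congr fun n => ?_
    rw [smul_inv_smul₀ (ht n).ne']
  set y := fun n => g (x n) - b n with hy
  have hyl : Tendsto y atTop (𝓝 (g x0)) := by
    simpa using (hgd.continuousAt.tendsto.comp hx).sub hb0
  have hyq : Tendsto (fun n => (t n)⁻¹ • (y n - g x0)) atTop (𝓝 (A ξ)) := by
    have := (aux_diffquot hgd hx hxq).sub hbq
    rw [sub_zero] at this
    refine this.congr fun n => ?_
    rw [← smul_sub]; congr 1; simp only [hy]; abel
  have hyK : ∀ n, y n ∈ K := fun n => (hk n).2.1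
  have hBn : Tendsto (fun n => fderiv ℝ Ξ (y n)) atTop (𝓝 B) :=
    hder.continuousAt.tendsto.comp hyl
  obtain ⟨c, hc, hcev⟩ := aux_lower_nhds hsurj
  have hmex : ∀ᶠ n in atTop, ∃ m', m' ∈ nCone D (Ξ (y n)) ∧
      ContinuousLinearMap.adjoint (fderiv ℝ Ξ (y n)) m' = l n := by
    filter_upwards [hBn.eventually hcev, hyl.eventually (hU.mem_nhds hyU)] with n hn hnU
    obtain ⟨m', h1, h2⟩ := aux_normal (hst _ hnU) hn.1 hU hnU hredU hDcv (hk n).2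
    exact ⟨m', h1, h2⟩
  have hmex' : ∀ n, ∃ m', (∃ m', m' ∈ nCone D (Ξ (y n)) ∧
      ContinuousLinearMap.adjoint (fderiv ℝ Ξ (y n)) m' = l n) → (m' ∈ nCone D (Ξ (y n)) ∧
      ContinuousLinearMap.adjoint (fderiv ℝ Ξ (y n)) m' = l n) := by
    intro n
    by_cases h : ∃ m', m' ∈ nCone D (Ξ (y n)) ∧
      ContinuousLinearMap.adjoint (fderiv ℝ Ξ (y n)) m' = l n
    · obtain ⟨m', hm'⟩ := h
      exact ⟨m', fun _ => hm'⟩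
    · exact ⟨0, fun h' => absurd h' h⟩
  choose M hM0 using hmex'
  have hM : ∀ᶠ n in atTop, M n ∈ nCone D (Ξ (y n)) ∧
      ContinuousLinearMap.adjoint (fderiv ℝ Ξ (y n)) (M n) = l n :=
    hmex.mono fun n hn => hM0 n hn
  have hMl : Tendsto M atTop (𝓝 μ) := by
    rw [← tendsto_sub_nhds_zero_iff]
    have hz : Tendsto (fun n => c⁻¹ * ‖l n - ContinuousLinearMap.adjoint (fderiv ℝ Ξ (y n)) μ‖)
        atTop (𝓝 0) := by
      have := ((hl.sub (aux_adjT hBn (tendsto_const_nhds (x := μ)))).norm.const_mul c⁻¹)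
      rw [← hlμ] at this
      simpa using this
    refine squeeze_zero_norm' ?_ hz
    filter_upwards [hM, hBn.eventually hcev] with n hn hcn
    have := hcn.2 (M n - μ)
    rw [map_sub, hn.2] at this
    rwa [← div_eq_inv_mul, le_div_iff₀ hc, mul_comm]
  -- `A ξ` is critical
  have hAξT : A ξ ∈ contCone K (g x0) := by
    refine ⟨t, fun n => (t n)⁻¹ • (y n - g x0), ht, ht0, hyq, fun n => ?_⟩
    rw [smul_inv_smul₀ (ht n).ne']
    simpa using hyK n
  have hBAD : B (A ξ) ∈ D := (aux_tangent (hst _ hyU) hsurj hU hyU hredU hD hΞ0 _).1 hAξT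
  have hμBA : ⟪μ, B (A ξ)⟫ = 0 := by
    have h1 := aux_diffquot (hst _ hyU).hasFDerivAt hyl hyq
    have h2 : Tendsto (fun n => ⟪M n, (t n)⁻¹ • (Ξ (y n) - Ξ (g x0))⟫) atTop
      (𝓝 ⟪μ, B (A ξ)⟫) := hMl.inner h1
    refine tendsto_nhds_unique h2 (tendsto_const_nhds.congr' ?_)
    filter_upwards [hM] with n hn
    rw [hΞ0, sub_zero, inner_smul_right, (hnD _ _ hn.1).2, mul_zero]
  have hAξ : A ξ ∈ criticalCone K (g x0) l0 := (hcrit _).2 ⟨hBAD, hμBA⟩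
  -- the limiting equation
  set H := hessLxx f g x0 l0 with hH
  set ζs := fun n => (t n)⁻¹ • ContinuousLinearMap.adjoint B (M n - μ) with hζs
  set T := ContinuousLinearMap.adjoint (B2 (A ξ)) μ with hT
  have hgd2 : HasFDerivAt (fderiv ℝ g) (fderiv ℝ (fderiv ℝ g) x0) x0 := by
    have h1 : ContDiff ℝ 1 (fderiv ℝ g) := hg.fderiv_right (by norm_num)
    exact (h1.differentiable (by norm_num) x0).hasFDerivAt
  have hlim : Tendsto (fun n => ContinuousLinearMap.adjoint A (ζs n)) atTop
      (𝓝 (-(H ξ) - ContinuousLinearMap.adjoint A T)) := by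
    have e1 := aux_diffquot (aux_hess hf hg l0 x0) hx hxq
    have e2 := aux_adjT (aux_diffquot hgd2 hx hxq) (tendsto_sub_nhds_zero_iff.2 hl)
    have e3 := aux_adjT (tendsto_const_nhds (x := A)) (aux_adjT (aux_diffquot hder hyl hyq) hMl)
    have e4 := ((haq.sub e1).sub e2).sub e3
    rw [map_zero, zero_sub, sub_zero] at e4
    refine e4.congr' ?_
    filter_upwards [hM] with n hn
    rw [aux_adj_smul_sub, aux_adj_smul_sub, hn.2, map_smul, ← smul_sub, ← smul_sub, ← smul_sub,
      hζs]
    simp only []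
    rw [map_smul]
    congr 1
    have k1 := (hk n).1
    have k0 := hKKT.1
    simp only [] at k1 k0
    rw [k0, ← k1]
    have : ContinuousLinearMap.adjoint B μ = l0 := hlμ.symm
    simp only [map_sub, this]
    abel
  have hζmem : ∀ᶠ n in atTop, ζs n ∈ negPolar (criticalCone K (g x0) l0) := by
    filter_upwards [hM] with n hn d hd
    obtain ⟨h1, h2⟩ := (hcrit d).1 hd
    rw [hζs]
    simp only []
    rw [real_inner_smul_left, ContinuousLinearMap.adjoint_inner_left, inner_sub_left, h2, sub_zero]
    exact mul_nonpos_of_nonneg_of_nonpos (inv_pos.2 (ht n)).le ((hnD _ _ hn.1).1 _ h1)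
  obtain ⟨ζ, hζ, hζe⟩ := hclosed.mem_of_tendsto hlim
    (hζmem.mono fun n hn => mem_image_of_mem _ hn)
  have hquad : (1 / 2 : ℝ) • gradient (fun h : Y => ⟪μ, B2 h h⟫) (A ξ) = T :=
    aux_gradQuad B2 hsym μ (A ξ)
  have heq : H ξ + ContinuousLinearMap.adjoint A (ζ + T) = 0 := by
    rw [map_add, hζe]; abel
  have hge := hpos ξ ζ (by rw [hquad]; exact heq) hAξ hζ
  have hzero : ⟪ζ, A ξ⟫ = 0 := by
    apply le_antisymm (hζ _ hAξ)
    rw [real_inner_comm]; exact hge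
  obtain ⟨η, hη⟩ := aux_mem_range_adj B ζ fun d hd => hζ d ((hcrit d).2 (by
    rw [hd, inner_zero_right]
    exact ⟨by simpa using hDcone 0 le_rfl _ hBAD, rfl⟩))
  have hηD : ∀ z ∈ D, ⟪μ, z⟫ = 0 → ⟪η, z⟫ ≤ 0 := by
    intro z hz hμz
    obtain ⟨d, rfl⟩ := hsurj z
    rw [← ContinuousLinearMap.adjoint_inner_left, hη]
    exact hζ d ((hcrit d).2 ⟨hz, hμz⟩)
  have hηe : ⟪η, B (A ξ)⟫ = 0 := by
    rw [← ContinuousLinearMap.adjoint_inner_left, hη]; exact hzero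
  have hdir := aux_dirDeriv (hst _ hyU) hsurj hder hdiffev hU hyU hredU hKne hKcl hKcv hD hΞ0
    hμD hBAD hμBA hηD hηe
  rw [← hlμ, hη] at hdir
  exact hnc ξ (ζ + T) heq hdir

end
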